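/- Let Δ ≥ 1 and k ≥ 3 be integers. Then the Ramsey number of any k-uniform hypergraph H with n vertices and maximum degree at most Δ satisfies r(H) ≤ r_k(kΔ)^{(2kΔ²)^{kΔ}}·n, where r_k(l) denotes the 2-colour Ramsey number of the complete k-uniform hypergraph K_l^{(k)} on l vertices. -/

import Mathlib

open Finset

/-- The 2-colour Ramsey number r_k(l) of the complete k-uniform hypergraph on l vertices:
the least N such that every 2-colouring of the k-element subsets of an N-element set contains
an l-element subset all of whose k-element subsets receive the same colour. -/
noncomputable def cliqueRamsey (k l : ℕ) : ℕ :=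
  sInf {N : ℕ | ∀ χ : Finset (Fin N) → Bool,
    ∃ W : Finset (Fin N), W.card = l ∧ ∃ b : Bool, ∀ e ⊆ W, e.card = k → χ e = b}

/-- Off-diagonal finite Ramsey theorem for uniform hypergraphs. -/
theorem exists_ramsey (k p q : ℕ) : ∃ N : ℕ, ∀ (S : Finset ℕ) (χ : Finset ℕ → Bool), N ≤ #S →
    (∃ W ⊆ S, #W = p ∧ ∀ e ⊆ W, #e = k → χ e = true) ∨
    (∃ W ⊆ S, #W = q ∧ ∀ e ⊆ W, #e = k → χ e = false) := by
  induction k generalizing p q with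
  | zero =>
    refine ⟨max p q, fun S χ hS => ?_⟩
    cases h : χ ∅ with
    | true =>
      obtain ⟨W, hW, hc⟩ := exists_subset_card_eq (le_trans (le_max_left p q) hS)
      exact Or.inl ⟨W, hW, hc, fun e _ he => by rw [card_eq_zero.1 he, h]⟩
    | false =>
      obtain ⟨W, hW, hc⟩ := exists_subset_card_eq (le_trans (le_max_right p q) hS)
      exact Or.inr ⟨W, hW, hc, fun e _ he => by rw [card_eq_zero.1 he, h]⟩
  | succ k ih =>
    have extend : ∀ (χ : Finset ℕ → Bool) (b : Bool) (x : ℕ) (W U : Finset ℕ), W ⊆ U →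
        (∀ e ⊆ U, #e = k → χ (insert x e) = b) → (∀ e ⊆ W, #e = k + 1 → χ e = b) →
        ∀ e ⊆ insert x W, #e = k + 1 → χ e = b := by
      intro χ b x W U hWU hU hW e he hc
      by_cases hx : x ∈ e
      · have := hU (e.erase x) ((subset_insert_iff.1 he).trans hWU)
          (by rw [card_erase_of_mem hx, hc]; rfl)
        rwa [insert_erase hx] at this
      · exact hW e ((subset_insert_iff_of_notMem hx).1 he) hc
    induction p generalizing q with
    | zero =>
      refine ⟨0, fun S χ _ => Or.inl ⟨∅, empty_subset _, rfl, fun e he hc => ?_⟩⟩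
      rw [subset_empty.1 he] at hc
      simp at hc
    | succ p ihp =>
      induction q with
      | zero =>
        refine ⟨0, fun S χ _ => Or.inr ⟨∅, empty_subset _, rfl, fun e he hc => ?_⟩⟩
        rw [subset_empty.1 he] at hc
        simp at hc
      | succ q ihq =>
        obtain ⟨P, hP⟩ := ihp (q + 1)
        obtain ⟨Q, hQ⟩ := ihq
        obtain ⟨M, hM⟩ := ih P Q
        refine ⟨M + 1, fun S χ hS => ?_⟩
        obtain ⟨x, hx⟩ : S.Nonempty := card_pos.1 (by omega)
        have hS' : M ≤ #(S.erase x) := by rw [card_erase_of_mem hx]; omega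
        rcases hM (S.erase x) (fun e => χ (insert x e)) hS' with ⟨U, hU, hc, hmono⟩ | ⟨U, hU, hc, hmono⟩
        · rcases hP U χ hc.ge with ⟨W, hW, hWc, hWm⟩ | ⟨W, hW, hWc, hWm⟩
          · refine Or.inl ⟨insert x W, ?_, ?_, extend χ true x W U hW hmono hWm⟩
            · exact insert_subset hx ((hW.trans hU).trans (erase_subset _ _))
            · rw [card_insert_of_notMem fun h => notMem_erase x S (hU (hW h)), hWc]
          · exact Or.inr ⟨W, (hW.trans hU).trans (erase_subset _ _), hWc, hWm⟩
        · rcases hQ U χ hc.ge with ⟨W, hW, hWc, hWm⟩ | ⟨W, hW, hWc, hWm⟩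
          · exact Or.inl ⟨W, (hW.trans hU).trans (erase_subset _ _), hWc, hWm⟩
          · refine Or.inr ⟨insert x W, ?_, ?_, extend χ false x W U hW hmono hWm⟩
            · exact insert_subset hx ((hW.trans hU).trans (erase_subset _ _))
            · rw [card_insert_of_notMem fun h => notMem_erase x S (hU (hW h)), hWc]

theorem cliqueRamsey_spec (k l : ℕ) (χ : Finset (Fin (cliqueRamsey k l)) → Bool) :
    ∃ W : Finset (Fin (cliqueRamsey k l)), #W = l ∧ ∃ b : Bool, ∀ e ⊆ W, #e = k → χ e = b := by
  refine Nat.sInf_mem (s := {N : ℕ | ∀ χ : Finset (Fin N) → Bool,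
    ∃ W : Finset (Fin N), W.card = l ∧ ∃ b : Bool, ∀ e ⊆ W, e.card = k → χ e = b}) ?_ χ
  obtain ⟨N, hN⟩ := exists_ramsey k l l
  refine ⟨N, fun χ => ?_⟩
  have pull : ∀ b : Bool, (∃ W ⊆ range N, #W = l ∧ ∀ e ⊆ W, #e = k →
      χ (univ.filter fun i : Fin N => (i : ℕ) ∈ e) = b) →
      ∃ W : Finset (Fin N), #W = l ∧ ∃ b : Bool, ∀ e ⊆ W, #e = k → χ e = b := by
    rintro b ⟨W, hW, hc, hm⟩
    refine ⟨univ.filter fun i : Fin N => (i : ℕ) ∈ W, ?_, b, fun e he hek => ?_⟩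
    · rw [← hc, ← card_map Fin.valEmbedding]
      congr 1
      ext i
      simp only [mem_map, mem_filter, mem_univ, true_and, Fin.valEmbedding_apply]
      exact ⟨by rintro ⟨j, hj, rfl⟩; exact hj, fun h => ⟨⟨i, mem_range.1 (hW h)⟩, h, rfl⟩⟩
    · have := hm (e.map Fin.valEmbedding) (fun i hi => ?_) (by rw [card_map, hek])
      · rw [← this]
        congr 1
        ext i
        simp [Fin.val_inj]
      · obtain ⟨j, hj, rfl⟩ := mem_map.1 hi
        exact (mem_filter.1 (he hj)).2
  rcases hN (range N) (fun e => χ (univ.filter fun i : Fin N => (i : ℕ) ∈ e)) (by simp) with h | h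
  · exact pull true h
  · exact pull false h

theorem le_cliqueRamsey (k l : ℕ) : l ≤ cliqueRamsey k l := by
  obtain ⟨W, hW, -⟩ := cliqueRamsey_spec k l fun _ => true
  simpa [hW] using card_le_univ W

/-- A hypergraph has a proper strong colouring with more than `Δ * (k - 1)` colours. -/
theorem exists_strong_coloring {α : Type*} [Fintype α] [DecidableEq α] (H : Finset (Finset α))
    (Δ k l : ℕ) (hk : ∀ e ∈ H, #e = k) (hΔ : ∀ v, #(H.filter fun e => v ∈ e) ≤ Δ)
    (hl : Δ * (k - 1) < l) : ∃ c : α → Fin l, ∀ e ∈ H, Set.InjOn c e := by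
  suffices h : ∀ S : Finset α, ∃ c : α → Fin l, ∀ e ∈ H, Set.InjOn c (e ∩ S : Finset α) by
    obtain ⟨c, hc⟩ := h univ
    exact ⟨c, fun e he => by simpa using hc e he⟩
  intro S
  induction S using Finset.induction_on with
  | empty => exact ⟨fun _ => ⟨0, by omega⟩, fun e _ => by simp⟩
  | insert v S hv ih =>
    obtain ⟨c, hc⟩ := ih
    let F : Finset (Fin l) := ((H.filter fun e => v ∈ e).biUnion fun e => e.erase v).image c
    have hF : #F < #(univ : Finset (Fin l)) := by
      rw [card_univ, Fintype.card_fin]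
      refine lt_of_le_of_lt (card_image_le.trans (card_biUnion_le_card_mul _ _ (k - 1) ?_)) ?_
      · intro e he
        rw [mem_filter] at he
        rw [card_erase_of_mem he.2, hk e he.1]
      · exact lt_of_le_of_lt (Nat.mul_le_mul_right _ (hΔ v)) hl
    obtain ⟨a, -, ha⟩ := exists_mem_notMem_of_card_lt_card hF
    have key : ∀ e ∈ H, ∀ w ∈ e, v ∈ e → w ≠ v → c w ≠ a := by
      rintro e he w hw hve hwv rfl
      exact ha (mem_image_of_mem c (mem_biUnion.2
        ⟨e, mem_filter.2 ⟨he, hve⟩, mem_erase.2 ⟨hwv, hw⟩⟩))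
    refine ⟨Function.update c v a, fun e he x hx y hy hxy => ?_⟩
    simp only [coe_inter, coe_insert, Set.mem_inter_iff, mem_coe, Set.mem_insert_iff] at hx hy
    by_cases hxv : x = v
    · subst hxv
      by_contra hne
      have hyx : y ≠ x := fun h => hne h.symm
      rw [Function.update_self, Function.update_of_ne hyx] at hxy
      exact key e he y hy.1 hx.1 hyx hxy.symm
    · by_cases hyv : y = v
      · subst hyv
        rw [Function.update_self, Function.update_of_ne hxv] at hxy
        exact absurd hxy (key e he x hx.1 hy.1 hxv)
      · rw [Function.update_of_ne hxv, Function.update_of_ne hyv] at hxy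
        refine hc e he ?_ ?_ hxy
        · simpa using ⟨hx.1, hx.2.resolve_left hxv⟩
        · simpa using ⟨hy.1, hy.2.resolve_left hyv⟩

section Counting

variable {X Y I V : Type*} [Fintype X] [DecidableEq X] [Fintype Y] [DecidableEq Y]
  [Fintype I] [DecidableEq I] [Fintype V]

theorem sum_sum_update {M : Type*} [AddCommMonoid M] (u : X) (F : (X → V) → M) :
    ∑ g : X → V, ∑ a : V, F (Function.update g u a) = Fintype.card V • ∑ g : X → V, F g := by
  let σ : (X → V) × V → (X → V) × V := fun p => (Function.update p.1 u p.2, p.1 u)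
  have hσ : Function.Involutive σ := by
    rintro ⟨g, a⟩
    simp [σ]
  calc ∑ g : X → V, ∑ a : V, F (Function.update g u a)
      = ∑ p : (X → V) × V, F (σ p).1 :=
        (Fintype.sum_prod_type' fun g a => F (Function.update g u a)).symm
    _ = ∑ p : (X → V) × V, F p.1 :=
        Equiv.sum_comp hσ.toPerm fun p : (X → V) × V => F p.1
    _ = Fintype.card V • ∑ g : X → V, F g := by
        rw [Fintype.sum_prod_type, smul_sum]
        simp

theorem card_filter_comp_injective (ψ : Y → X) (hψ : Function.Injective ψ)
    (Q : (Y → V) → Prop) [DecidablePred Q] :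
    #{g : X → V | Q (g ∘ ψ)} * Fintype.card V ^ Fintype.card Y =
      #{h : Y → V | Q h} * Fintype.card V ^ Fintype.card X := by
  classical
  let e : (X → V) ≃ (Y → V) × ({x // x ∉ Set.range ψ} → V) :=
    (Equiv.piEquivPiSubtypeProd (fun x => x ∈ Set.range ψ) fun _ => V).trans
      (Equiv.prodCongr ((Equiv.ofInjective ψ hψ).symm.arrowCongr (Equiv.refl V)) (Equiv.refl _))
  have he : ∀ g, (e g).1 = g ∘ ψ := fun g => rfl
  have h1 : #{g : X → V | Q (g ∘ ψ)} =
      #{h : Y → V | Q h} * Fintype.card ({x // x ∉ Set.range ψ} → V) := by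
    rw [← card_univ, ← card_product, ← card_map e.toEmbedding]
    congr 1
    ext p
    simp only [mem_map_equiv, mem_filter, mem_univ, true_and, mem_product, and_true]
    rw [← he, e.apply_symm_apply]
  have h2 : Fintype.card V ^ Fintype.card X = Fintype.card V ^ Fintype.card Y *
      Fintype.card ({x // x ∉ Set.range ψ} → V) := by
    have := Fintype.card_congr e
    rwa [Fintype.card_prod, Fintype.card_fun, Fintype.card_fun] at this
  rw [h1, h2]
  ring

theorem card_filter_comp_injOn {J : Type*} (u : J → X) (r : X → I)
    (hr : Set.InjOn r (Set.range u)) (Q : (J → V) → Prop) [DecidablePred Q] :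
    #{g : X → V | Q (g ∘ u)} * Fintype.card V ^ Fintype.card I =
      #{z : I → V | Q (z ∘ r ∘ u)} * Fintype.card V ^ Fintype.card X := by
  classical
  rcases isEmpty_or_nonempty V with hV | hV
  · rcases isEmpty_or_nonempty X with hX | hX
    · have hJ : IsEmpty J := Function.isEmpty u
      have h1 : ∀ (g : X → V), g ∘ u = hJ.elim := fun g => Subsingleton.elim _ _
      have h2 : ∀ (z : I → V), z ∘ r ∘ u = hJ.elim := fun g => Subsingleton.elim _ _
      simp only [h1, h2]
      by_cases hQ : Q hJ.elim <;> simp [hQ]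
    · have hI : Nonempty I := hX.map r
      simp
  let u' : J → Set.range u := Set.rangeFactorization u
  let Q' : (Set.range u → V) → Prop := fun h => Q (h ∘ u')
  have h1 := card_filter_comp_injective (V := V) (Subtype.val : Set.range u → X)
    Subtype.val_injective Q'
  have h2 := card_filter_comp_injective (V := V) (fun y : Set.range u => r y)
    (fun a b h => Subtype.ext (hr a.2 b.2 h)) Q'
  have h1' : #{g : X → V | Q' (g ∘ Subtype.val)} = #{g : X → V | Q (g ∘ u)} := rfl
  have h2' : #{z : I → V | Q' (z ∘ fun y : Set.range u => r y)} =
    #{z : I → V | Q (z ∘ r ∘ u)} := rfl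
  rw [h1'] at h1
  rw [h2'] at h2
  have hpos : 0 < Fintype.card V ^ Fintype.card (Set.range u) := pow_pos Fintype.card_pos _
  apply Nat.eq_of_mul_eq_mul_right hpos
  calc _ = #{g : X → V | Q (g ∘ u)} * Fintype.card V ^ Fintype.card (Set.range u) *
        Fintype.card V ^ Fintype.card I := by ring
    _ = #{z : I → V | Q (z ∘ r ∘ u)} * Fintype.card V ^ Fintype.card (Set.range u) *
        Fintype.card V ^ Fintype.card X := by rw [h1, h2]; ring
    _ = _ := by ring

end Counting

/-- The ordered `l`-tuples all of whose `k`-subtuples have colour `b`. -/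
def monoTuples {V : Type*} [Fintype V] [DecidableEq V] (k l : ℕ) (χ : Finset V → Bool) (b : Bool) :
    Finset (Fin l → V) :=
  univ.filter fun x => ∀ e : Finset (Fin l), #e = k → χ (e.image x) = b

theorem exists_dense_monoTuples {V : Type*} [Fintype V] [DecidableEq V] [Nonempty V] (k l : ℕ)
    (hR : 2 ≤ cliqueRamsey k l) (χ : Finset V → Bool) :
    ∃ b, Fintype.card V ^ l ≤ cliqueRamsey k l ^ (l + 1) * #(monoTuples k l χ b) := by
  set R := cliqueRamsey k l with hRdef
  have cover : (univ : Finset (Fin R → V)) ⊆ (univ : Finset (Fin l → Fin R)).biUnion fun ι =>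
      (univ : Finset Bool).biUnion fun b =>
        univ.filter fun g => Function.Injective ι ∧ g ∘ ι ∈ monoTuples k l χ b := by
    intro g _
    obtain ⟨W, hW, b, hb⟩ := cliqueRamsey_spec k l fun e => χ (e.image g)
    let ι := W.orderEmbOfFin hW
    refine mem_biUnion.2 ⟨ι, mem_univ _, mem_biUnion.2 ⟨b, mem_univ _, mem_filter.2
      ⟨mem_univ _, ι.injective, mem_filter.2 ⟨mem_univ _, fun e he => ?_⟩⟩⟩⟩
    have := hb (e.image ι) (fun x hx => ?_) (by rw [card_image_of_injective _ ι.injective, he])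
    · rw [image_image] at this
      exact this
    · obtain ⟨i, -, rfl⟩ := mem_image.1 hx
      exact W.orderEmbOfFin_mem hW i
  have hV : 0 < Fintype.card V := Fintype.card_pos
  have each : ∀ (ι : Fin l → Fin R) (b : Bool),
      #{g : Fin R → V | Function.Injective ι ∧ g ∘ ι ∈ monoTuples k l χ b} *
        Fintype.card V ^ l ≤ #(monoTuples k l χ b) * Fintype.card V ^ R := by
    intro ι b
    by_cases hι : Function.Injective ι
    · have := card_filter_comp_injective (V := V) ι hι (fun x => x ∈ monoTuples k l χ b)
      simp only [Fintype.card_fin, filter_univ_mem] at this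
      simp only [hι, true_and]
      exact this.le
    · simp [hι]
  have total : Fintype.card V ^ R * Fintype.card V ^ l ≤
      Fintype.card V ^ R *
        (R ^ l * (#(monoTuples k l χ true) + #(monoTuples k l χ false))) := by
    calc Fintype.card V ^ R * Fintype.card V ^ l
        = #(univ : Finset (Fin R → V)) * Fintype.card V ^ l := by simp
      _ ≤ (∑ ι : Fin l → Fin R, ∑ b : Bool,
          #{g : Fin R → V | Function.Injective ι ∧ g ∘ ι ∈ monoTuples k l χ b}) *
            Fintype.card V ^ l := by
          gcongr
          exact (card_le_card cover).trans (card_biUnion_le.trans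
            (sum_le_sum fun ι _ => card_biUnion_le))
      _ ≤ ∑ ι : Fin l → Fin R, ∑ b : Bool, #(monoTuples k l χ b) * Fintype.card V ^ R := by
          rw [sum_mul]
          refine sum_le_sum fun ι _ => ?_
          rw [sum_mul]
          exact sum_le_sum fun b _ => each ι b
      _ = _ := by
          simp only [Fintype.sum_bool, sum_const, card_univ, Fintype.card_fun, Fintype.card_fin,
            smul_eq_mul]
          ring
  have main := Nat.le_of_mul_le_mul_left total (pow_pos hV _)
  have bound : ∀ s m : ℕ, s ≤ 2 * m → R ^ l * s ≤ R ^ (l + 1) * m := fun s m h => by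
    calc R ^ l * s ≤ R ^ l * (R * m) := by gcongr; nlinarith
      _ = _ := by ring
  rcases le_total #(monoTuples k l χ true) #(monoTuples k l χ false) with h | h
  · exact ⟨false, main.trans (bound _ _ (by omega))⟩
  · exact ⟨true, main.trans (bound _ _ (by omega))⟩

section Step

variable {X V : Type*} [Fintype X] [DecidableEq X] [Fintype V] [DecidableEq V] {l : ℕ}

/-- The tuples whose `i`-th coordinate may be replaced by each of `x 0, …, x (t - 1)`,
staying in `G`. -/
def commonLink {t : ℕ} (i : Fin l) (G : Finset (Fin l → V)) (x : Fin t → V) :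
    Finset (Fin l → V) :=
  univ.filter fun y => ∀ s, Function.update y i (x s) ∈ G

/-- The values at coordinate `i` completing every tuple `y a` with `a ∈ A` to an element of `G`. -/
noncomputable def completions {A : Type*} (i : Fin l) (G : Finset (Fin l → V)) (p : A → Prop)
    (y : A → Fin l → V) : Finset V :=
  open Classical in univ.filter fun b => ∀ a, p a → Function.update (y a) i b ∈ G

omit [DecidableEq V] in
theorem mem_completions {A : Type*} {i : Fin l} {G : Finset (Fin l → V)} {p : A → Prop}
    {y : A → Fin l → V} {b : V} :
    b ∈ completions i G p y ↔ ∀ a, p a → Function.update (y a) i b ∈ G := by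
  simp [completions]

/-- All tuples `y a` lie in `G'` but they have few common completions in `G`. -/
def Dangerous {A : Type*} (β : ℝ) (i : Fin l) (G G' : Finset (Fin l → V)) (p : A → Prop)
    (y : A → Fin l → V) : Prop :=
  (∀ a, p a → y a ∈ G') ∧ (#(completions i G p y) : ℝ) < β * Fintype.card V

theorem sum_card_commonLink_ge (t : ℕ) (ht : 1 ≤ t) (i : Fin l) (G : Finset (Fin l → V)) (d : ℝ)
    (hd : 0 ≤ d) (hV : 0 < Fintype.card V) (hG : d * (Fintype.card V : ℝ) ^ l ≤ #G) :
    (Fintype.card V : ℝ) ^ t * (d ^ t * (Fintype.card V : ℝ) ^ l) ≤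
      ∑ x : Fin t → V, (#(commonLink i G x) : ℝ) := by
  have hN : (0 : ℝ) < Fintype.card V := by exact_mod_cast hV
  set N : ℝ := (Fintype.card V : ℝ)
  let q : (Fin l → V) → Finset V := fun y => univ.filter fun a => Function.update y i a ∈ G
  have h1 : ∑ x : Fin t → V, (#(commonLink i G x) : ℝ) = ∑ y : Fin l → V, (#(q y) : ℝ) ^ t := by
    have : ∀ y : Fin l → V, (#(q y) : ℝ) ^ t =
        ∑ x : Fin t → V, if ∀ s, Function.update y i (x s) ∈ G then (1 : ℝ) else 0 := by
      intro y
      rw [sum_boole]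
      have : (univ.filter fun x : Fin t → V => ∀ s, Function.update y i (x s) ∈ G) =
          Fintype.piFinset fun _ => q y := by
        ext x
        simp [q, Fintype.mem_piFinset]
      rw [this, Fintype.card_piFinset]
      simp
    simp_rw [this]
    rw [sum_comm]
    refine sum_congr rfl fun x _ => ?_
    rw [sum_boole]
    rfl
  have h2 : ∑ y : Fin l → V, (#(q y) : ℝ) = N * #G := by
    have := sum_sum_update (V := V) i (fun y => if y ∈ G then (1 : ℝ) else 0)
    simpa [q, sum_boole] using this
  obtain ⟨t, rfl⟩ : ∃ t', t = t' + 1 := ⟨t - 1, by omega⟩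
  have h3 := pow_sum_div_card_le_sum_pow (s := (univ : Finset (Fin l → V)))
    (f := fun y => (#(q y) : ℝ)) (fun _ _ => by positivity) t
  rw [h1]
  refine le_trans ?_ h3
  rw [h2, card_univ, Fintype.card_fun, Fintype.card_fin, Nat.cast_pow,
    le_div_iff₀ (by positivity)]
  calc N ^ (t + 1) * (d ^ (t + 1) * N ^ l) * (N ^ l) ^ t
      = (N * (d * N ^ l)) ^ (t + 1) := by ring
    _ ≤ (N * #G) ^ (t + 1) := by gcongr

open Classical in
theorem sum_card_dangerous_le {I A : Type*} [Fintype I] [DecidableEq I] [Nonempty A] (t : ℕ)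
    (i : Fin l) (G : Finset (Fin l → V)) (β : ℝ) (hβ : 0 ≤ β) (p : A → Fin l → I) :
    ∑ x : Fin t → V, (#{z : I → V |
        Dangerous β i G (commonLink i G x) (fun _ => True) fun a j => z (p a j)} : ℝ) ≤
      (Fintype.card V : ℝ) ^ Fintype.card I * (β * Fintype.card V) ^ t := by
  have key : ∀ z : I → V, ∑ x : Fin t → V, (if Dangerous β i G (commonLink i G x)
      (fun _ => True) (fun a j => z (p a j)) then (1 : ℝ) else 0) ≤ (β * Fintype.card V) ^ t := by
    intro z
    let C := completions i G (fun _ => True) fun (a : A) j => z (p a j)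
    by_cases hC : (#C : ℝ) < β * Fintype.card V
    · rw [sum_boole]
      calc _ ≤ ((#(Fintype.piFinset fun _ : Fin t => C) : ℕ) : ℝ) := by
            refine Nat.cast_le.2 (card_le_card fun x hx => ?_)
            have := (mem_filter.1 hx).2.1
            refine Fintype.mem_piFinset.2 fun s => mem_filter.2 ⟨mem_univ _, fun a _ => ?_⟩
            exact (mem_filter.1 (this a trivial)).2 s
        _ = (#C : ℝ) ^ t := by simp [Fintype.card_piFinset]
        _ ≤ _ := by gcongr
    · have : ∀ x : Fin t → V, ¬ Dangerous β i G (commonLink i G x)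
        (fun _ => True) (fun a j => z (p a j)) := fun x hx => hC hx.2
      simp only [this, if_false, sum_const_zero]
      positivity
  calc _ = ∑ z : I → V, ∑ x : Fin t → V, (if Dangerous β i G (commonLink i G x)
      (fun _ => True) (fun a j => z (p a j)) then (1 : ℝ) else 0) := by
        rw [sum_comm]
        exact sum_congr rfl fun x _ => (sum_boole _ _).symm
    _ ≤ ∑ z : I → V, (β * Fintype.card V) ^ t := sum_le_sum fun z _ => key z
    _ = _ := by simp

open Classical in
theorem exists_link_of_pattern (t Δ D : ℕ) (ht : 1 ≤ t) (hΔ : 1 ≤ Δ) (hD : D = Δ * l)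
    (i : Fin l) (G : Finset (Fin l → V)) (d β : ℝ) (hd : 0 ≤ d) (hβ : 0 < β)
    (hβd : 2 * β ≤ d ^ t) (hV : 0 < Fintype.card V)
    (hG : d * (Fintype.card V : ℝ) ^ l ≤ #G) :
    ∃ x : Fin t → V,
      d ^ t / 2 * (Fintype.card V : ℝ) ^ l ≤ #(commonLink i G x) ∧
      ∀ p : Fin Δ × Fin l → Fin D,
        (#{z : Fin D → V | Dangerous β i G (commonLink i G x) (fun _ => True)
          fun a j => z (p (a, j))} : ℝ) ≤
        (D : ℝ) ^ D * β ^ (t - 1) * (Fintype.card V : ℝ) ^ D := by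
  have : Nonempty V := Fintype.card_pos_iff.1 hV
  have : Nonempty (Fin Δ) := ⟨⟨0, hΔ⟩⟩
  have hN : (0 : ℝ) < Fintype.card V := by exact_mod_cast hV
  have hDpos : 0 < D := hD ▸ Nat.mul_pos hΔ i.pos
  have hcard : ∀ x : Fin t → V, (#(commonLink i G x) : ℝ) ≤ (Fintype.card V : ℝ) ^ l := by
    intro x
    have := card_le_univ (commonLink i G x)
    rw [Fintype.card_fun, Fintype.card_fin] at this
    exact_mod_cast this
  have hA := sum_card_commonLink_ge t ht i G d hd hV hG
  let bad : (Fin t → V) → (Fin Δ × Fin l → Fin D) → ℝ := fun x p =>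
    (#{z : Fin D → V | Dangerous β i G (commonLink i G x) (fun _ => True)
      fun a j => z (p (a, j))} : ℝ)
  have hB : ∑ x, ∑ p, bad x p ≤
      (D : ℝ) ^ D * ((Fintype.card V : ℝ) ^ D * (β * Fintype.card V) ^ t) := by
    rw [sum_comm]
    calc _ ≤ ∑ p : Fin Δ × Fin l → Fin D,
          (Fintype.card V : ℝ) ^ D * (β * Fintype.card V) ^ t := by
          refine sum_le_sum fun p _ => ?_
          have := sum_card_dangerous_le t i G β hβ.le fun a j => p (a, j)
          rwa [Fintype.card_fin] at this
      _ = _ := by simp [hD]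
  have hbad : ∀ x p, 0 ≤ bad x p := fun x p => Nat.cast_nonneg _
  suffices h : ∃ x : Fin t → V,
      d ^ t / 2 * (Fintype.card V : ℝ) ^ l ≤ #(commonLink i G x) ∧
      ∀ p, bad x p ≤ (D : ℝ) ^ D * β ^ (t - 1) * (Fintype.card V : ℝ) ^ D from h
  clear_value bad
  have hcardt : (#(univ : Finset (Fin t → V)) : ℝ) = (Fintype.card V : ℝ) ^ t := by simp
  generalize (Fintype.card V : ℝ) = N at *
  set ε : ℝ := (D : ℝ) ^ D * β ^ (t - 1) with hε
  have hεpos : 0 < ε := by positivity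
  obtain ⟨x, hx⟩ : ∃ x : Fin t → V,
      ε * (d ^ t / 2) * N ^ l * N ^ D ≤
        ε * #(commonLink i G x) * N ^ D - (∑ p, bad x p) * N ^ l := by
    by_contra! hcon
    have h1 := sum_lt_sum_of_nonempty (univ_nonempty (α := Fin t → V)) fun x _ => hcon x
    rw [sum_sub_distrib, ← sum_mul, ← sum_mul, ← mul_sum, sum_const, nsmul_eq_mul] at h1
    rw [hcardt] at h1
    have h2 : ε * (N ^ t * (d ^ t * N ^ l)) * N ^ D ≤
      ε * (∑ x : Fin t → V, (#(commonLink i G x) : ℝ)) * N ^ D := by gcongr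
    have h3 : (∑ x, ∑ p, bad x p) * N ^ l ≤ (D : ℝ) ^ D * (N ^ D * (β * N) ^ t) * N ^ l := by
      gcongr
    have h4 : (D : ℝ) ^ D * (N ^ D * (β * N) ^ t) * N ^ l = ε * β * (N ^ t * N ^ l * N ^ D) := by
      have : β ^ t = β ^ (t - 1) * β := by rw [← pow_succ, Nat.sub_add_cancel ht]
      rw [mul_pow, this, hε]
      ring
    have h5 : ε * β * (N ^ t * N ^ l * N ^ D) ≤ ε * (d ^ t / 2) * (N ^ t * N ^ l * N ^ D) := by
      gcongr
      linarith
    have h6 : N ^ t * (ε * (d ^ t / 2) * N ^ l * N ^ D) =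
      ε * (d ^ t / 2) * (N ^ t * N ^ l * N ^ D) := by ring
    have h7 : ε * (N ^ t * (d ^ t * N ^ l)) * N ^ D =
      2 * (ε * (d ^ t / 2) * (N ^ t * N ^ l * N ^ D)) := by ring
    linarith
  have hs : 0 ≤ ∑ p, bad x p := sum_nonneg fun p _ => hbad x p
  refine ⟨x, ?_, fun p => ?_⟩
  · have h1 : 0 ≤ (∑ p, bad x p) * N ^ l := by positivity
    have h2 : (ε * N ^ D) * (d ^ t / 2 * N ^ l) ≤ (ε * N ^ D) * #(commonLink i G x) := by
      linarith
    exact le_of_mul_le_mul_left h2 (by positivity)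
  · refine (single_le_sum (f := bad x) (fun p _ => hbad x p) (mem_univ p)).trans ?_
    have h1 : 0 ≤ ε * (d ^ t / 2) * N ^ l * N ^ D := by positivity
    have h2 : ε * #(commonLink i G x) * N ^ D ≤ ε * N ^ l * N ^ D := by
      gcongr
      exact hcard x
    have h3 : (∑ p, bad x p) * N ^ l ≤ (ε * N ^ D) * N ^ l := by linarith
    exact le_of_mul_le_mul_right h3 (by positivity)

open Classical in
/-- One dependent random choice: passing to a common link of `t` vertices in part `i`. -/
theorem exists_link (X : Type*) [Fintype X] [DecidableEq X] (t Δ D : ℕ) (ht : 1 ≤ t) (hΔ : 1 ≤ Δ)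
    (hD : D = Δ * l) (i : Fin l) (G : Finset (Fin l → V)) (d β : ℝ) (hd : 0 ≤ d) (hβ : 0 < β)
    (hβd : 2 * β ≤ d ^ t) (hV : 0 < Fintype.card V)
    (hG : d * (Fintype.card V : ℝ) ^ l ≤ #G) :
    ∃ x : Fin t → V,
      d ^ t / 2 * (Fintype.card V : ℝ) ^ l ≤ #(commonLink i G x) ∧
      ∀ u : Fin Δ → Fin l → X,
        (#{g : X → V | Dangerous β i G (commonLink i G x) (fun _ => True)
          fun a j => g (u a j)} : ℝ) ≤
        (D : ℝ) ^ D * β ^ (t - 1) * (Fintype.card V : ℝ) ^ Fintype.card X := by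
  have hN : (0 : ℝ) < Fintype.card V := by exact_mod_cast hV
  have hDpos : 0 < D := hD ▸ Nat.mul_pos hΔ i.pos
  obtain ⟨x, hx, hbad⟩ := exists_link_of_pattern t Δ D ht hΔ hD i G d β hd hβ hβd hV hG
  refine ⟨x, hx, fun u => ?_⟩
  let u' : Fin Δ × Fin l → X := fun q => u q.1 q.2
  let Y : Finset X := univ.image u'
  have hY : #Y ≤ #(univ : Finset (Fin D)) := card_image_le.trans (by simp [hD])
  obtain ⟨r, hr⟩ : ∃ r : X → Fin D, Set.InjOn r Y := by
    obtain ⟨T, -, hT⟩ := exists_subset_card_eq hY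
    let e : Y ≃ T := equivOfCardEq hT.symm
    refine ⟨fun v => if h : v ∈ Y then e ⟨v, h⟩ else ⟨0, hDpos⟩, fun a ha b hb hab => ?_⟩
    rw [mem_coe] at ha hb
    simp only [ha, hb, dif_pos] at hab
    simpa using e.injective (Subtype.ext hab)
  have hr' : Set.InjOn r (Set.range u') := by
    convert hr
    ext; simp [Y]
  have h1 := card_filter_comp_injOn (V := V) u' r hr' fun h : Fin Δ × Fin l → V =>
    Dangerous β i G (commonLink i G x) (fun _ => True) fun a j => h (a, j)
  have h2 := hbad (r ∘ u')
  rw [Fintype.card_fin] at h1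
  have h3 := congrArg (Nat.cast : ℕ → ℝ) h1
  rw [Nat.cast_mul, Nat.cast_mul, Nat.cast_pow, Nat.cast_pow] at h3
  have h4 := mul_le_mul_of_nonneg_right h2
    (by positivity : (0 : ℝ) ≤ (Fintype.card V : ℝ) ^ Fintype.card X)
  refine le_of_mul_le_mul_right (h3.le.trans (h4.trans_eq ?_))
    (by positivity : (0 : ℝ) < (Fintype.card V : ℝ) ^ D)
  ring

end Step

section Embedding

variable {X E V : Type*} [Fintype X] [DecidableEq X] [Fintype E]
  [Fintype V] [DecidableEq V] {l : ℕ}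

/-- The number of maps that land in `B` after being made to agree with `f` on `S`. -/
def countExtensions (B : Finset (X → V)) (S : Finset X) (f : X → V) : ℕ :=
  #{g : X → V | S.piecewise f g ∈ B}

omit [Fintype X] [Fintype V] [DecidableEq V] in
theorem piecewise_insert_update (S : Finset X) (u : X) (f g : X → V) (a : V) :
    (insert u S).piecewise (Function.update f u a) g = Function.update (S.piecewise f g) u a := by
  ext w
  by_cases hw : w = u
  · subst hw; simp
  · simp [hw, Finset.piecewise]

theorem sum_countExtensions (B : Finset (X → V)) (S : Finset X) (f : X → V) (u : X) (hu : u ∉ S) :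
    ∑ a, countExtensions B (insert u S) (Function.update f u a) =
      Fintype.card V * countExtensions B S f := by
  have := sum_sum_update (V := V) u fun g => if S.piecewise f g ∈ B then 1 else 0
  rw [sum_comm] at this
  simp only [countExtensions, card_filter, piecewise_insert_update]
  rw [smul_eq_mul] at this
  rw [← this]
  refine sum_congr rfl fun a _ => sum_congr rfl fun g _ => ?_
  congr 2
  ext w
  by_cases hw : w = u
  · subst hw; simp [hu]
  · simp [hw, Finset.piecewise]

theorem card_filter_countExtensions_lt (B : Finset (X → V)) (S : Finset X) (f : X → V) (u : X)
    (hu : u ∉ S) (K : ℝ) :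
    (#{a | K * countExtensions B S f < countExtensions B (insert u S) (Function.update f u a)} : ℝ)
      * K ≤ Fintype.card V := by
  have hsum := sum_countExtensions B S f u hu
  set n := countExtensions B S f
  let m : V → ℕ := fun a => countExtensions B (insert u S) (Function.update f u a)
  change ∑ a, m a = _ at hsum
  change (#{a | K * n < m a} : ℝ) * K ≤ _
  rcases Nat.eq_zero_or_pos n with h0 | hpos
  · rw [h0, mul_zero, sum_eq_zero_iff] at hsum
    have : ∀ a, m a = 0 := fun a => hsum a (mem_univ a)
    simp [this, h0]
  · have hpos' : (0 : ℝ) < n := by exact_mod_cast hpos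
    refine le_of_mul_le_mul_right ?_ hpos'
    calc (#{a | K * n < m a} : ℝ) * K * n = ∑ a with K * n < m a, K * n := by
          rw [sum_const, nsmul_eq_mul, mul_assoc]
      _ ≤ ∑ a with K * n < m a, (m a : ℝ) := sum_le_sum fun a ha => (mem_filter.1 ha).2.le
      _ ≤ ∑ a, (m a : ℝ) := sum_le_sum_of_subset_of_nonneg (filter_subset _ _)
          fun _ _ _ => Nat.cast_nonneg _
      _ = Fintype.card V * n := by exact_mod_cast hsum

theorem exists_good_extension (B : X → Finset (X → V)) (S : Finset X) (f : X → V) (u : X)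
    (hu : u ∉ S) (β : ℝ) (hβ : 0 < β) (D : ℕ) (hD : 0 < D) (T : Finset X) (hT : #T ≤ D)
    (C U : Finset V) (hC : β * Fintype.card V ≤ #C) (hU : (#U : ℝ) < β * Fintype.card V / 2) :
    ∃ a ∈ C, a ∉ U ∧ ∀ v ∈ T,
      (countExtensions (B v) (insert u S) (Function.update f u a) : ℝ) ≤
        2 * D / β * countExtensions (B v) S f := by
  have hD' : (0 : ℝ) < D := by exact_mod_cast hD
  let bad : X → Finset V := fun v => {a | 2 * D / β * countExtensions (B v) S f <
    countExtensions (B v) (insert u S) (Function.update f u a)}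
  have hbad : ∀ v, (#(bad v) : ℝ) ≤ β * Fintype.card V / (2 * D) := by
    intro v
    have := card_filter_countExtensions_lt (B v) S f u hu (2 * D / β)
    change (#(bad v) : ℝ) * (2 * D / β) ≤ _ at this
    rw [le_div_iff₀ (by positivity)]
    calc (#(bad v) : ℝ) * (2 * D) = β * (#(bad v) * (2 * D / β)) := by field_simp
      _ ≤ _ := by gcongr
  have hlt : (#(T.biUnion bad ∪ U) : ℝ) < #C := by
    calc (#(T.biUnion bad ∪ U) : ℝ) ≤ (∑ v ∈ T, #(bad v) : ℕ) + #U := by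
          exact_mod_cast (card_union_le _ _).trans (Nat.add_le_add_right card_biUnion_le _)
      _ ≤ #T * (β * Fintype.card V / (2 * D)) + #U := by
          push_cast
          gcongr
          rw [← nsmul_eq_mul]
          exact sum_le_card_nsmul _ _ _ fun v _ => hbad v
      _ ≤ D * (β * Fintype.card V / (2 * D)) + #U := by gcongr
      _ = β * Fintype.card V / 2 + #U := by field_simp
      _ < #C := by linarith
  obtain ⟨a, haC, ha⟩ := exists_mem_notMem_of_card_lt_card (by exact_mod_cast hlt)
  rw [mem_union, not_or] at ha
  refine ⟨a, haC, ha.2, fun v hv => ?_⟩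
  by_contra! h
  exact ha.1 (mem_biUnion.2 ⟨v, hv, mem_filter.2 ⟨mem_univ _, h⟩⟩)

/-- Level `m` of a nested family depends only on the coordinates from `m` on. -/
def DependsFrom (m : ℕ) (G : Finset (Fin l → V)) : Prop :=
  ∀ y y' : Fin l → V, (∀ j : Fin l, m ≤ j → y j = y' j) → y ∈ G → y' ∈ G

open Classical in
theorem exists_partite_embedding (φ : E → Fin l → X) (c : X → Fin l) (hc : ∀ e j, c (φ e j) = j)
    (Δ D : ℕ) (hD : 0 < D) (hΔD : Δ * l ≤ D) (hdeg : ∀ v, #{e | φ e (c v) = v} ≤ Δ)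
    (β ε : ℝ) (hβ : 0 < β) (hε : ε * (2 * D / β) ^ D < 1) (hβ2 : β ≤ 2 * D)
    (A : Finset X) (hA : (#A : ℝ) < β * Fintype.card V / 2)
    (G : ℕ → Finset (Fin l → V)) (hdep : ∀ m, DependsFrom m (G m))
    (htop : ∀ m, l ≤ m → G m = univ)
    (hB : ∀ v, (#{g : X → V | Dangerous β (c v) (G (c v)) (G (c v + 1)) (fun e => φ e (c v) = v)
      fun e j => g (φ e j)} : ℝ) ≤ ε * (Fintype.card V : ℝ) ^ Fintype.card X) :
    ∃ f : X → V, Set.InjOn f A ∧ ∀ e, (fun j => f (φ e j)) ∈ G 0 := by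
  have hV : (0 : ℝ) < Fintype.card V := by
    by_contra! h
    have : β * Fintype.card V ≤ 0 := mul_nonpos_of_nonneg_of_nonpos hβ.le h
    have := Nat.cast_nonneg (α := ℝ) #A
    linarith
  have : Nonempty V := Fintype.card_pos_iff.1 (by exact_mod_cast hV)
  set K : ℝ := 2 * D / β with hK
  have hK1 : 1 ≤ K := by rw [hK, le_div_iff₀ hβ]; linarith
  let B : X → Finset (X → V) := fun v => {g | Dangerous β (c v) (G (c v)) (G (c v + 1))
    (fun e => φ e (c v) = v) fun e j => g (φ e j)}
  let Nb : X → Finset X := fun v => {w | c v < c w ∧ ∃ e, φ e (c v) = v ∧ φ e (c w) = w}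
  let T : X → Finset X := fun u =>
    (({e | φ e (c u) = u} : Finset E) ×ˢ (univ : Finset (Fin l))).image fun q => φ q.1 q.2
  have hT : ∀ u, #(T u) ≤ D := by
    intro u
    refine card_image_le.trans ?_
    rw [card_product, card_univ, Fintype.card_fin]
    exact (Nat.mul_le_mul_right _ (hdeg u)).trans hΔD
  have hNbT : ∀ v, Nb v ⊆ T v := by
    intro v w hw
    obtain ⟨-, -, e, hev, hew⟩ := mem_filter.1 hw
    exact mem_image.2 ⟨(e, c w), mem_product.2 ⟨mem_filter.2 ⟨mem_univ _, hev⟩, mem_univ _⟩, hew⟩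
  have hTNb : ∀ v u, u ∈ Nb v → v ∈ T u := by
    intro v w hw
    obtain ⟨-, -, e, hev, hew⟩ := mem_filter.1 hw
    exact mem_image.2 ⟨(e, c v), mem_product.2 ⟨mem_filter.2 ⟨mem_univ _, hew⟩, mem_univ _⟩, hev⟩
  have hNbD : ∀ v, #(Nb v) ≤ D := fun v => (card_le_card (hNbT v)).trans (hT v)
  -- dependence of the dangerous event on the later neighbours only
  have hBdep : ∀ v (g g' : X → V), (∀ w ∈ Nb v, g w = g' w) → g ∈ B v → g' ∈ B v := by
    intro v g g' hgg hg
    have agree : ∀ e, φ e (c v) = v → ∀ j, c v < j → g (φ e j) = g' (φ e j) := by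
      intro e he j hj
      refine hgg _ (mem_filter.2 ⟨mem_univ _, by rwa [hc], e, he, by rw [hc]⟩)
    obtain ⟨h1, h2⟩ := (mem_filter.1 hg).2
    refine mem_filter.2 ⟨mem_univ _, fun e he => ?_, lt_of_le_of_lt (Nat.cast_le.2 ?_) h2⟩
    · refine hdep _ _ _ (fun j hj => agree e he j ?_) (h1 e he)
      exact Fin.lt_def.2 hj
    · refine card_le_card fun b hb => mem_completions.2 fun e he => ?_
      refine hdep _ _ _ (fun j hj => ?_) (mem_completions.1 hb e he)
      by_cases hj' : j = c v
      · subst hj'; simp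
      · rw [Function.update_of_ne hj', Function.update_of_ne hj']
        exact (agree e he j (lt_of_le_of_ne (Fin.le_def.2 hj) (Ne.symm hj'))).symm
  have main : ∀ n ≤ Fintype.card X, ∃ (S : Finset X) (f : X → V), #S = n ∧
      (∀ u ∈ S, ∀ w ∉ S, c w ≤ c u) ∧ Set.InjOn f (S ∩ A : Finset X) ∧
      (∀ v, (countExtensions (B v) S f : ℝ) ≤
        ε * (Fintype.card V : ℝ) ^ Fintype.card X * K ^ #(S ∩ Nb v)) ∧
      ∀ e (m : ℕ), (∀ j : Fin l, m ≤ j → φ e j ∈ S) → (fun j => f (φ e j)) ∈ G m := by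
    intro n
    induction n with
    | zero =>
      intro _
      refine ⟨∅, fun _ => Classical.arbitrary V, rfl, by simp, by simp, fun v => ?_, ?_⟩
      · simpa [countExtensions] using hB v
      · intro e m hm
        have : l ≤ m := by
          by_contra! h
          simpa using hm ⟨m, h⟩ le_rfl
        rw [htop m this]
        exact mem_univ _
    | succ n ih =>
      intro hn
      obtain ⟨S, f, hS, hup, hinj, hcount, hG⟩ := ih (by omega)
      have hne : (univ \ S).Nonempty := by
        rw [← card_pos, card_sdiff_of_subset (subset_univ _), card_univ]
        omega
      obtain ⟨u, huS, humax⟩ := exists_max_image (univ \ S) c hne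
      have hu : u ∉ S := (mem_sdiff.1 huS).2
      have hhigh : ∀ w, c u < c w → w ∈ S := by
        intro w hw
        by_contra hwS
        exact absurd (humax w (mem_sdiff.2 ⟨mem_univ _, hwS⟩)) (not_le.2 hw)
      have hNbS : Nb u ⊆ S := fun w hw => hhigh w (mem_filter.1 hw).2.1
      let C : Finset V := completions (c u) (G (c u)) (fun e => φ e (c u) = u)
        fun e j => f (φ e j)
      have hC : β * Fintype.card V ≤ #C := by
        by_contra! hlt
        have hfB : f ∈ B u := by
          refine mem_filter.2 ⟨mem_univ _, fun e he => hG e _ fun j hj => hhigh _ ?_, hlt⟩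
          rw [hc]
          exact Fin.lt_def.2 hj
        have hall : countExtensions (B u) S f = Fintype.card V ^ Fintype.card X := by
          rw [countExtensions, filter_true_of_mem, card_univ, Fintype.card_fun]
          exact fun g _ => hBdep u f _ (fun w hw => by simp [hNbS hw]) hfB
        have h1 := hcount u
        rw [hall, inter_eq_right.2 hNbS, Nat.cast_pow] at h1
        have hP : (0 : ℝ) < (Fintype.card V : ℝ) ^ Fintype.card X := by positivity
        have hε0 : 0 ≤ ε := by
          by_contra! hneg
          have h2 : ε * (Fintype.card V : ℝ) ^ Fintype.card X * K ^ #(Nb u) < 0 :=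
            mul_neg_of_neg_of_pos (mul_neg_of_neg_of_pos hneg hP) (by positivity)
          linarith
        have h3 : ε * K ^ #(Nb u) ≤ ε * K ^ D := by
          gcongr
          exact hNbD u
        have h4 : (Fintype.card V : ℝ) ^ Fintype.card X * (ε * K ^ #(Nb u)) <
            (Fintype.card V : ℝ) ^ Fintype.card X * 1 := by
          gcongr
          linarith
        linarith
      let U : Finset V := (S ∩ A).image f
      have hU : (#U : ℝ) < β * Fintype.card V / 2 := by
        refine lt_of_le_of_lt (Nat.cast_le.2 (card_image_le.trans (card_le_card ?_))) hA
        exact inter_subset_right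
      obtain ⟨a, haC, haU, ha⟩ := exists_good_extension B S f u hu β hβ D hD (T u) (hT u) C U hC hU
      refine ⟨insert u S, Function.update f u a, by rw [card_insert_of_notMem hu, hS], ?_, ?_,
        fun v => ?_, ?_⟩
      · intro x hx w hw
        rw [mem_insert, not_or] at hw
        rcases mem_insert.1 hx with rfl | hx
        · exact humax w (mem_sdiff.2 ⟨mem_univ _, hw.2⟩)
        · exact hup x hx w hw.2
      · have hnew : ∀ x ∈ S, x ∈ A → f x ≠ a := by
          rintro x hxS hxA rfl
          exact haU (mem_image_of_mem f (mem_inter.2 ⟨hxS, hxA⟩))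
        have hneu : ∀ x ∈ S, x ≠ u := fun x hx h => hu (h ▸ hx)
        intro x hx y hy hxy
        rw [mem_coe, mem_inter, mem_insert] at hx hy
        rcases hx with ⟨rfl | hxS, hxA⟩ <;> rcases hy with ⟨rfl | hyS, hyA⟩
        · rfl
        · rw [Function.update_self, Function.update_of_ne (hneu y hyS)] at hxy
          exact absurd hxy.symm (hnew y hyS hyA)
        · rw [Function.update_self, Function.update_of_ne (hneu x hxS)] at hxy
          exact absurd hxy (hnew x hxS hxA)
        · rw [Function.update_of_ne (hneu x hxS),
            Function.update_of_ne (hneu y hyS)] at hxy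
          exact hinj (mem_coe.2 (mem_inter.2 ⟨hxS, hxA⟩)) (mem_coe.2 (mem_inter.2 ⟨hyS, hyA⟩)) hxy
      · by_cases huv : u ∈ Nb v
        · have h1 := ha v (hTNb v u huv)
          have h2 : #(insert u S ∩ Nb v) = #(S ∩ Nb v) + 1 := by
            rw [insert_inter_of_mem huv, card_insert_of_notMem]
            exact fun h => hu (mem_inter.1 h).1
          rw [h2, pow_succ]
          calc _ ≤ K * (countExtensions (B v) S f : ℝ) := h1
            _ ≤ K * (ε * (Fintype.card V : ℝ) ^ Fintype.card X * K ^ #(S ∩ Nb v)) := by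
                gcongr
                exact hcount v
            _ = _ := by ring
        · rw [insert_inter_of_notMem huv]
          refine le_trans (Nat.cast_le.2 (card_le_card fun g hg => ?_)) (hcount v)
          have hg' := (mem_filter.1 hg).2
          rw [piecewise_insert_update] at hg'
          refine mem_filter.2 ⟨mem_univ _, hBdep v _ _ (fun w hw => ?_) hg'⟩
          rw [Function.update_of_ne]
          rintro rfl
          exact huv hw
      · intro e m hm
        by_cases hue : ∃ j : Fin l, m ≤ j ∧ φ e j = u
        · obtain ⟨j, hmj, hj⟩ := hue
          have hju : j = c u := by rw [← hj, hc]
          subst hju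
          have hme : m = c u := by
            by_contra hne
            have hlt : m < c u := by omega
            let i : Fin l := ⟨m, hlt.trans (c u).isLt⟩
            have hi := hm i le_rfl
            have hiu : φ e i ≠ u := by
              intro h
              have := hc e i
              rw [h] at this
              rw [this] at hlt
              exact lt_irrefl _ hlt
            have hiS := mem_of_mem_insert_of_ne hi hiu
            have := hup _ hiS u hu
            rw [hc] at this
            exact absurd (Fin.le_def.1 this) (not_le.2 hlt)
          rw [hme]
          have := mem_completions.1 haC e hj
          refine hdep _ _ _ (fun j _ => ?_) this
          by_cases hj' : j = c u
          · subst hj'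
            simp [hj]
          · rw [Function.update_of_ne hj', Function.update_of_ne]
            intro h
            exact hj' (by rw [← hc e j, h])
        · push Not at hue
          refine hdep _ _ _ (fun j hj => ?_) (hG e m fun j hj => ?_)
          · rw [Function.update_of_ne (hue j hj)]
          · exact mem_of_mem_insert_of_ne (hm j hj) (hue j hj)
  obtain ⟨S, f, hS, -, hinj, -, hG⟩ := main _ le_rfl
  have hSu : S = univ := (card_eq_iff_eq_univ S).1 hS
  subst hSu
  exact ⟨f, by simpa using hinj, fun e => hG e 0 fun j _ => mem_univ _⟩

end Embedding

section Levels

variable {V : Type*} [Fintype V] [DecidableEq V] {l : ℕ}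

theorem DependsFrom.commonLink {t : ℕ} {i : Fin l} {G : Finset (Fin l → V)}
    (hG : DependsFrom (i : ℕ) G) (x : Fin t → V) : DependsFrom (i + 1 : ℕ) (commonLink i G x) := by
  intro y y' hyy hy
  refine mem_filter.2 ⟨mem_univ _, fun s => hG _ _ (fun j hj => ?_) ((mem_filter.1 hy).2 s)⟩
  by_cases hj' : j = i
  · subst hj'; simp
  · rw [Function.update_of_ne hj', Function.update_of_ne hj']
    exact hyy j (Nat.succ_le_of_lt (lt_of_le_of_ne hj fun h => hj' (Fin.ext h.symm)))

theorem le_card_completions_last {A : Type*} (i : Fin l) (hi : (i : ℕ) + 1 = l)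
    (G : Finset (Fin l → V)) (hG : DependsFrom (i : ℕ) G) (β : ℝ) (hV : 0 < Fintype.card V)
    (hcard : β * (Fintype.card V : ℝ) ^ l ≤ #G) (p : A → Prop) (y : A → Fin l → V) :
    β * Fintype.card V ≤ #(completions i G p y) := by
  have hN : (0 : ℝ) < Fintype.card V := by exact_mod_cast hV
  let C : Finset V := {b | (fun _ => b) ∈ G}
  have hmem : ∀ (z : Fin l → V) b, Function.update z i b ∈ G ↔ b ∈ C := by
    intro z b
    have agree : ∀ j : Fin l, (i : ℕ) ≤ j → Function.update z i b j = b := by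
      intro j hj
      have : j = i := Fin.ext (by omega)
      subst this
      simp
    rw [mem_filter]
    exact ⟨fun h => ⟨mem_univ _, hG _ _ agree h⟩,
      fun h => hG _ _ (fun j hj => (agree j hj).symm) h.2⟩
  have hC : C ⊆ completions i G p y := fun b hb => mem_completions.2 fun a _ => (hmem _ _).2 hb
  have hsum := sum_sum_update (V := V) i fun z => if z ∈ G then (1 : ℝ) else 0
  simp only [hmem, sum_boole, filter_univ_mem, sum_const, card_univ, Fintype.card_fun,
    Fintype.card_fin, nsmul_eq_mul, Nat.cast_pow] at hsum
  refine le_trans ?_ (Nat.cast_le.2 (card_le_card hC))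
  refine le_of_mul_le_mul_left ?_ (pow_pos hN l)
  rw [hsum]
  calc (Fintype.card V : ℝ) ^ l * (β * Fintype.card V)
      = Fintype.card V * (β * (Fintype.card V : ℝ) ^ l) := by ring
    _ ≤ _ := by gcongr

open Classical in
/-- Iterating dependent random choice through all the parts. -/
theorem exists_levels (X : Type*) [Fintype X] [DecidableEq X] (t Δ D : ℕ) (ht : 1 ≤ t)
    (hΔ : 1 ≤ Δ) (hD : D = Δ * l) (hl : 0 < l) (d : ℕ → ℝ) (β : ℝ) (hβ : 0 < β)
    (hdβ : ∀ i < l, β ≤ d i) (hd : ∀ i, i + 1 < l → d (i + 1) ≤ d i ^ t / 2)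
    (hV : 0 < Fintype.card V) (T : Finset (Fin l → V))
    (hT : d 0 * (Fintype.card V : ℝ) ^ l ≤ #T) :
    ∃ G : ℕ → Finset (Fin l → V), G 0 = T ∧ (∀ m, DependsFrom m (G m)) ∧
      (∀ m, l ≤ m → G m = univ) ∧ ∀ (i : Fin l) (u : Fin Δ → Fin l → X),
        (#{g : X → V | Dangerous β i (G i) (G (i + 1)) (fun _ => True)
          fun a j => g (u a j)} : ℝ) ≤
        (D : ℝ) ^ D * β ^ (t - 1) * (Fintype.card V : ℝ) ^ Fintype.card X := by
  have step : ∀ m < l, ∃ G : ℕ → Finset (Fin l → V), G 0 = T ∧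
      (∀ i ≤ m, DependsFrom i (G i) ∧ d i * (Fintype.card V : ℝ) ^ l ≤ #(G i)) ∧
      ∀ (i : Fin l), (i : ℕ) < m → ∀ (u : Fin Δ → Fin l → X),
        (#{g : X → V | Dangerous β i (G i) (G (i + 1)) (fun _ => True)
          fun a j => g (u a j)} : ℝ) ≤
        (D : ℝ) ^ D * β ^ (t - 1) * (Fintype.card V : ℝ) ^ Fintype.card X := by
    intro m
    induction m with
    | zero =>
      intro _
      refine ⟨fun _ => T, rfl, fun i hi => ?_, fun i hi => absurd hi (Nat.not_lt_zero _)⟩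
      obtain rfl : i = 0 := by omega
      exact ⟨fun y y' h hy => by rwa [← funext fun j => h j (Nat.zero_le _)], hT⟩
    | succ m ih =>
      intro hm
      have hml : m < l := by omega
      obtain ⟨G, h0, h1, h2⟩ := ih (by omega)
      have h3 := hd m hm
      have h4 := hdβ (m + 1) hm
      have h5 := hdβ m (by omega)
      obtain ⟨x, hx, hbad⟩ := exists_link X t Δ D ht hΔ hD ⟨m, hml⟩ (G m) (d m) β
        (hβ.le.trans h5) hβ (by linarith) hV (h1 m le_rfl).2
      let L : Finset (Fin l → V) := commonLink ⟨m, hml⟩ (G m) x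
      have hold : ∀ i ≤ m, Function.update G (m + 1) L i = G i :=
        fun i hi => Function.update_of_ne (by omega) _ _
      refine ⟨Function.update G (m + 1) L, by rw [hold 0 (Nat.zero_le _), h0], fun i hi => ?_,
        fun i hi u => ?_⟩
      · rcases Nat.lt_or_ge m i with him | him
        · obtain rfl : i = m + 1 := by omega
          rw [Function.update_self]
          exact ⟨DependsFrom.commonLink (i := ⟨m, hml⟩) (h1 m le_rfl).1 x,
            le_trans (by gcongr) hx⟩
        · rw [hold i him]
          exact h1 i him
      · rcases Nat.lt_or_ge (i : ℕ) m with him | him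
        · rw [hold _ him.le, hold _ him]
          exact h2 i him u
        · obtain rfl : i = ⟨m, hml⟩ := Fin.ext (le_antisymm (by simp only; omega) him)
          simp only [hold m le_rfl, Function.update_self]
          exact hbad u
  obtain ⟨G, h0, h1, h2⟩ := step (l - 1) (by omega)
  refine ⟨fun m => if m < l then G m else univ, by simp only [hl, if_true, h0], fun m => ?_,
    fun m hm => if_neg (by omega), fun i u => ?_⟩
  · by_cases hm : m < l
    · simp only [hm, if_true]
      exact (h1 m (by omega)).1
    · simp only [hm, if_false]
      exact fun _ _ _ _ => mem_univ _
  · by_cases hi : (i : ℕ) + 1 < l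
    · simp only [hi, i.isLt, if_true]
      exact h2 i (by omega) u
    · have hi' : (i : ℕ) ≤ l - 1 := by omega
      have hnot : ∀ g : X → V, ¬ Dangerous β i (if (i : ℕ) < l then G i else univ)
          (if (i : ℕ) + 1 < l then G (i + 1) else univ) (fun _ => True)
          (fun (a : Fin Δ) j => g (u a j)) := by
        intro g hg
        have h3 := hg.2
        simp only [i.isLt, if_true] at h3
        have h4 : β * (Fintype.card V : ℝ) ^ l ≤ #(G i) :=
          le_trans (by gcongr; exact hdβ i i.isLt) (h1 i hi').2
        exact absurd h3 (not_lt.2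
          (le_card_completions_last i (by omega) (G i) (h1 i hi').1 β hV h4 _ _))
      simp only [hnot, filter_false, card_empty, Nat.cast_zero]
      positivity

omit [DecidableEq V] in
open Classical in
theorem card_dangerous_le_of_degree {X E : Type*} [Fintype X] [DecidableEq X] [Fintype E]
    (φ : E → Fin l → X) (Δ : ℕ) (p : E → Prop) (hp : #{e | p e} ≤ Δ)
    (i : Fin l) (G G' : Finset (Fin l → V)) (β M : ℝ) (hβ : β ≤ 1) (hM : 0 ≤ M)
    (h : ∀ u : Fin Δ → Fin l → X, (#{g : X → V | Dangerous β i G G' (fun _ => True)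
      fun a j => g (u a j)} : ℝ) ≤ M) :
    (#{g : X → V | Dangerous β i G G' p fun e j => g (φ e j)} : ℝ) ≤ M := by
  by_cases hne : ∃ e, p e
  · obtain ⟨e₀, he₀⟩ := hne
    have : Nonempty {e // p e} := ⟨⟨e₀, he₀⟩⟩
    obtain ⟨s⟩ : Nonempty ({e // p e} ↪ Fin Δ) := by
      refine Function.Embedding.nonempty_of_card_le ?_
      rw [Fintype.card_subtype, Fintype.card_fin]
      exact hp
    let en : Fin Δ → {e // p e} := Function.invFun s
    have hen : Function.Surjective en := Function.invFun_surjective s.injective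
    refine le_trans (Nat.cast_le.2 (card_le_card fun g hg => ?_)) (h fun a => φ (en a))
    obtain ⟨h1, h2⟩ := (mem_filter.1 hg).2
    refine mem_filter.2 ⟨mem_univ _, fun a _ => h1 _ (en a).2, lt_of_le_of_lt ?_ h2⟩
    refine Nat.cast_le.2 (card_le_card fun b hb => mem_completions.2 fun e he => ?_)
    obtain ⟨a, ha⟩ := hen ⟨e, he⟩
    have := mem_completions.1 hb a trivial
    rwa [ha] at this
  · push Not at hne
    have hnot : ∀ g : X → V, ¬ Dangerous β i G G' p fun e j => g (φ e j) := by
      intro g hg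
      have h1 : completions i G p (fun e j => g (φ e j)) = univ :=
        eq_univ_of_forall fun b => mem_completions.2 fun e he => absurd he (hne e)
      have h2 := hg.2
      rw [h1, card_univ] at h2
      have : β * Fintype.card V ≤ 1 * Fintype.card V := by gcongr
      linarith
    simpa [hnot] using hM

/-- Sparse partite hypergraphs embed into dense partite hypergraphs of linear size. -/
theorem exists_embedding_of_dense {X E : Type*} [Fintype X] [DecidableEq X] [Fintype E]
    [DecidableEq E] (φ : E → Fin l → X) (c : X → Fin l) (hc : ∀ e j, c (φ e j) = j)
    (Δ D R : ℕ) (hΔ : 1 ≤ Δ) (hl : 3 ≤ l) (hD : D = Δ * l) (hR : 3 ≤ R) (hDR : D ≤ R ^ 2)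
    (hdeg : ∀ v, #{e | φ e (c v) = v} ≤ Δ) (A : Finset X)
    (hV : 0 < Fintype.card V) (hA : R ^ ((2 * D) ^ l) * #A ≤ Fintype.card V)
    (T : Finset (Fin l → V)) (hT : Fintype.card V ^ l ≤ R ^ (l + 1) * #T) :
    ∃ f : X → V, Set.InjOn f A ∧ ∀ e, (fun j => f (φ e j)) ∈ T := by
  have hD3 : 3 ≤ D := by rw [hD]; nlinarith
  have hR0 : (0 : ℝ) < R := by exact_mod_cast (by omega : 0 < R)
  have hN : (0 : ℝ) < Fintype.card V := by exact_mod_cast hV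
  have hR3 : (3 : ℝ) ≤ R := by exact_mod_cast hR
  have hDpos : (0 : ℝ) < D := by exact_mod_cast (by omega : 0 < D)
  set ρ : ℝ := (R : ℝ)⁻¹ with hρ
  have hρ0 : 0 < ρ := inv_pos.2 hR0
  have hρ3 : ρ ≤ 1 / 3 := by rw [hρ, inv_le_comm₀ hR0 (by norm_num)]; linarith
  have hρ1 : ρ ≤ 1 := by linarith
  have hρR : ρ * R = 1 := inv_mul_cancel₀ hR0.ne'
  set t := 2 * D with ht
  let a : ℕ → ℕ := fun i => (l + 2) * t ^ i - 1
  have ha : ∀ i, a i + 1 = (l + 2) * t ^ i := fun i =>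
    Nat.sub_add_cancel (Nat.mul_pos (by omega) (pow_pos (by omega) _))
  have hastep : ∀ i, a i * t + 1 ≤ a (i + 1) := by
    intro i
    have h1 := ha i
    have h2 := ha (i + 1)
    have h3 : (a i + 1) * t = a (i + 1) + 1 := by rw [h1, h2]; ring
    have : (a i + 1) * t = a i * t + t := by ring
    omega
  have hamono : Monotone a := by
    refine monotone_nat_of_le_succ fun i => ?_
    have := hastep i
    have : a i * 1 ≤ a i * t := Nat.mul_le_mul_left _ (by omega)
    omega
  let d : ℕ → ℝ := fun i => ρ ^ a i
  set β : ℝ := ρ ^ a (l - 1) with hβ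
  have hβ0 : 0 < β := pow_pos hρ0 _
  have hβ1 : β ≤ 1 := pow_le_one₀ hρ0.le hρ1
  have hbig : 10 ≤ a (l - 1) := by
    have h1 : a 1 ≤ a (l - 1) := hamono (by omega)
    have h2 := ha 1
    have h3 : 5 * 6 ≤ (l + 2) * t ^ 1 := by rw [pow_one]; exact Nat.mul_le_mul (by omega) (by omega)
    omega
  have hb : a (l - 1) + 1 ≤ t ^ l := by
    rw [ha]
    have h1 : t ^ l = t * t ^ (l - 1) := by rw [← pow_succ', Nat.sub_add_cancel (by omega)]
    rw [h1]
    refine Nat.mul_le_mul_right _ ?_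
    have : 1 * l ≤ D := hD ▸ Nat.mul_le_mul_right _ hΔ
    omega
  have hT' : d 0 * (Fintype.card V : ℝ) ^ l ≤ #T := by
    have h1 : a 0 = l + 1 := by have := ha 0; simp at this; omega
    have h2 : (Fintype.card V : ℝ) ^ l ≤ (R : ℝ) ^ (l + 1) * #T := by exact_mod_cast hT
    calc d 0 * (Fintype.card V : ℝ) ^ l ≤ ρ ^ (l + 1) * ((R : ℝ) ^ (l + 1) * #T) := by
          simp only [d, h1]; gcongr
      _ = #T := by rw [← mul_assoc, ← mul_pow, hρR, one_pow, one_mul]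
  have hA' : (#A : ℝ) < β * Fintype.card V / 2 := by
    rcases Nat.eq_zero_or_pos #A with h0 | hpos
    · rw [h0, Nat.cast_zero]; positivity
    · have hpos' : (0 : ℝ) < #A := by exact_mod_cast hpos
      have h1 : (R : ℝ) ^ (a (l - 1) + 1) * #A ≤ Fintype.card V := by
        have : R ^ (a (l - 1) + 1) * #A ≤ Fintype.card V :=
          (Nat.mul_le_mul_right _ (Nat.pow_le_pow_right (by omega) hb)).trans hA
        exact_mod_cast this
      have h2 : β * ((R : ℝ) ^ (a (l - 1) + 1) * #A) = R * #A := by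
        rw [pow_succ, hβ]
        calc _ = (ρ * R) ^ a (l - 1) * (R * #A) := by rw [mul_pow]; ring
          _ = _ := by rw [hρR, one_pow, one_mul]
      have h3 : R * #A ≤ β * Fintype.card V := by rw [← h2]; gcongr
      nlinarith
  obtain ⟨G, hG0, hdep, htop, hbad⟩ := exists_levels (V := V) (l := l) X t Δ D (by omega) hΔ hD
    (by omega) d β hβ0 (fun i hi => pow_le_pow_of_le_one hρ0.le hρ1 (hamono (by omega)))
    (fun i _ => by
      calc d (i + 1) ≤ ρ ^ (a i * t + 1) := pow_le_pow_of_le_one hρ0.le hρ1 (hastep i)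
        _ = (d i) ^ t * ρ := by rw [pow_succ, pow_mul]
        _ ≤ (d i) ^ t * (1 / 2) := by
            have : 0 ≤ d i ^ t := by positivity
            gcongr; linarith
        _ = _ := by ring) hV T hT'
  have hε : (D : ℝ) ^ D * β ^ (t - 1) * (2 * D / β) ^ D < 1 := by
    have h1 : t - 1 = (D - 1) + D := by omega
    have h2 : (D : ℝ) ^ D * β ^ (t - 1) * (2 * D / β) ^ D = (2 * D * D) ^ D * β ^ (D - 1) := by
      rw [h1, pow_add, div_pow, mul_pow (2 * (D : ℝ)) D]
      field_simp
    have h3 : (2 * D * D : ℝ) ≤ (R : ℝ) ^ 5 := by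
      have h4 : (D : ℝ) ≤ (R : ℝ) ^ 2 := by exact_mod_cast hDR
      calc (2 * D * D : ℝ) ≤ R * (R : ℝ) ^ 2 * (R : ℝ) ^ 2 := by gcongr; linarith
        _ = _ := by ring
    have h5 : β ≤ ρ ^ 10 := pow_le_pow_of_le_one hρ0.le hρ1 hbig
    rw [h2]
    calc (2 * D * D : ℝ) ^ D * β ^ (D - 1) ≤ ((R : ℝ) ^ 5) ^ D * (ρ ^ 10) ^ (D - 1) := by gcongr
      _ = (ρ * R) ^ (5 * D) * ρ ^ (10 * (D - 1) - 5 * D) := by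
          rw [mul_pow, ← pow_mul, ← pow_mul]
          have : 10 * (D - 1) = 5 * D + (10 * (D - 1) - 5 * D) := by omega
          conv_lhs => rw [this, pow_add]
          ring
      _ = ρ ^ (10 * (D - 1) - 5 * D) := by rw [hρR, one_pow, one_mul]
      _ < 1 := pow_lt_one₀ hρ0.le (by linarith) (by omega)
  have hD1 : (1 : ℝ) ≤ D := by exact_mod_cast (by omega : 1 ≤ D)
  obtain ⟨f, hf, hfT⟩ := exists_partite_embedding φ c hc Δ D (by omega) hD.ge
    (fun v => by convert hdeg v) β
    ((D : ℝ) ^ D * β ^ (t - 1)) hβ0 hε (by linarith) A hA' G hdep htop (fun v =>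
      card_dangerous_le_of_degree φ Δ _ (by convert hdeg v) (c v) _ _ β _ hβ1 (by positivity)
        (hbad (c v)))
  exact ⟨f, hf, fun e => hG0 ▸ hfT e⟩

end Levels

/-- Let Δ ≥ 1 and k ≥ 3. Then the Ramsey number of any k-uniform hypergraph H
with n vertices and maximum degree at most Δ satisfies r(H) ≤ r_k(kΔ)^{(2kΔ²)^{kΔ}}·n. -/
theorem stmt_5 :
    ∀ Δ k : ℕ, 1 ≤ Δ → 3 ≤ k →
    ∀ (n : ℕ) (H : Finset (Finset (Fin n))),
      (∀ e ∈ H, e.card = k) →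
      (∀ v : Fin n, (H.filter fun e => v ∈ e).card ≤ Δ) →
      ∀ N : ℕ, cliqueRamsey k (k * Δ) ^ ((2 * k * Δ ^ 2) ^ (k * Δ)) * n ≤ N →
        ∀ χ : Finset (Fin N) → Bool,
          ∃ f : Fin n → Fin N, Function.Injective f ∧
            ∃ b : Bool, ∀ e ∈ H, χ (e.image f) = b := by
  intro Δ k hΔ hk n H hH hdeg N hN χ
  rcases Nat.eq_zero_or_pos n with rfl | hn
  · refine ⟨Fin.elim0, fun x => x.elim0, true, fun e he => ?_⟩
    have h1 := hH e he
    rw [eq_empty_of_isEmpty e, card_empty] at h1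
    omega
  set l := k * Δ with hl
  set R := cliqueRamsey k l with hR
  have hkl : k ≤ l := Nat.le_mul_of_pos_right k hΔ
  have hΔl : Δ ≤ l := Nat.le_mul_of_pos_left Δ (by omega)
  have hlR : l ≤ R := le_cliqueRamsey k l
  have hNpos : 0 < N := lt_of_lt_of_le (Nat.mul_pos (pow_pos (by omega) _) hn) hN
  have : Nonempty (Fin N) := ⟨⟨0, hNpos⟩⟩
  obtain ⟨b, hb⟩ := exists_dense_monoTuples (V := Fin N) k l (by omega) χ
  obtain ⟨c, hc⟩ := exists_strong_coloring H Δ k l hH hdeg (by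
    rw [hl, Nat.mul_comm k]
    exact Nat.mul_lt_mul_of_pos_left (by omega) hΔ)
  -- complete every edge to an `l`-set by adding private dummy vertices
  let X := Fin n ⊕ (H × Fin l)
  let c' : X → Fin l := Sum.elim c Prod.snd
  let φ : H → Fin l → X := fun e j =>
    if h : ∃ w ∈ e.1, c w = j then Sum.inl h.choose else Sum.inr (e, j)
  have hφv : ∀ (e : H), ∀ v ∈ e.1, φ e (c v) = Sum.inl v := by
    intro e v hv
    have h : ∃ w ∈ e.1, c w = c v := ⟨v, hv, rfl⟩
    simp only [φ, dif_pos h]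
    exact congrArg Sum.inl (hc e.1 e.2 h.choose_spec.1 hv h.choose_spec.2)
  have hφc : ∀ e j, c' (φ e j) = j := by
    intro e j
    by_cases h : ∃ w ∈ e.1, c w = j
    · simp only [φ, dif_pos h]
      exact h.choose_spec.2
    · simp only [φ, dif_neg h]
      rfl
  have hφdeg : ∀ v, #{e | φ e (c' v) = v} ≤ Δ := by
    rintro (v | ⟨e, j⟩)
    · refine le_trans ?_ (hdeg v)
      rw [← card_map (Function.Embedding.subtype _)]
      refine card_le_card fun e he => ?_
      obtain ⟨e', he', rfl⟩ := mem_map.1 he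
      have h1 := (mem_filter.1 he').2
      refine mem_filter.2 ⟨e'.2, ?_⟩
      by_cases h : ∃ w ∈ e'.1, c w = c' (Sum.inl v)
      · simp only [φ, dif_pos h] at h1
        rw [← Sum.inl_injective h1]
        exact h.choose_spec.1
      · simp only [φ, dif_neg h] at h1
        exact absurd h1 (by simp)
    · refine le_trans (card_le_one.2 fun e₁ h₁ e₂ h₂ => ?_) hΔ
      have key : ∀ e' : H, φ e' (c' (Sum.inr (e, j))) = Sum.inr (e, j) → e' = e := by
        intro e' h'
        by_cases h : ∃ w ∈ e'.1, c w = c' (Sum.inr (e, j))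
        · simp only [φ, dif_pos h] at h'
          exact absurd h' (by simp)
        · simp only [φ, dif_neg h] at h'
          exact (Prod.ext_iff.1 (Sum.inr_injective h')).1
      rw [key e₁ (mem_filter.1 h₁).2, key e₂ (mem_filter.1 h₂).2]
  obtain ⟨f, hf, hfT⟩ := exists_embedding_of_dense φ c' hφc Δ (Δ * l) R hΔ (by omega) rfl (by omega)
    (by rw [pow_two]; exact Nat.mul_le_mul (hΔl.trans hlR) hlR) hφdeg
    (univ.image (Sum.inl : Fin n → X)) (by simpa using hNpos) (by
      rw [card_image_of_injective _ Sum.inl_injective, card_univ, Fintype.card_fin,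
        Fintype.card_fin]
      have : 2 * (Δ * l) = 2 * k * Δ ^ 2 := by rw [hl]; ring
      rwa [this]) (monoTuples k l χ b) hb
  refine ⟨fun v => f (Sum.inl v), fun v w hvw => ?_, b, fun e he => ?_⟩
  · exact Sum.inl_injective (hf (by simp) (by simp) hvw)
  · have h1 := (mem_filter.1 (hfT ⟨e, he⟩)).2 (e.image c)
      (by rw [card_image_of_injOn (hc e he), hH e he])
    rw [← h1, image_image]
    congr 1
    refine image_congr fun v hv => ?_
    simp only [Function.comp]
    rw [hφv ⟨e, he⟩ v hv]
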